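/- Let d ≥ 3 be an odd integer and m ≥ 2 an integer such that (d-1)/2 divides m-1. Then any finite simple graph G with maximum degree Δ(G) < d, matching number ν(G) < m, no isolated vertices, and exactly (d-1)(m-1) + (m-1) edges is isomorphic to the disjoint union of 2(m-1)/(d-1) copies of the complete graph K_d; in particular, the extremal graph without isolated vertices is unique up to isomorphism. -/

import Mathlib

open SimpleGraph

/-- `M` is a matching of `G`: a set of edges of `G` that are pairwise vertex-disjoint. -/
def IsMatchingSet {V : Type} (G : SimpleGraph V) (M : Set (Sym2 V)) : Prop :=
  M ⊆ G.edgeSet ∧ M.Pairwise fun e f => ∀ v : V, v ∈ e → v ∉ f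

/-- The matching number `ν(G)`: the maximum size of a matching in `G`. -/
noncomputable def nu {V : Type} (G : SimpleGraph V) : ℕ :=
  sSup {n | ∃ M : Set (Sym2 V), IsMatchingSet G M ∧ M.ncard = n}

/-- `v` is saturated (covered) by the matching `M`. -/
def MSaturates {V : Type} (M : Set (Sym2 V)) (v : V) : Prop := ∃ e ∈ M, v ∈ e

/-- The edges of the walk `p` alternate: the `i`-th edge belongs to `M` iff `i` is odd
(so the walk starts with a non-matching edge). -/
def IsAlternating {V : Type} (M : Set (Sym2 V)) {G : SimpleGraph V} {a b : V}
    (p : G.Walk a b) : Prop :=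
  ∀ (i : ℕ) (h : i < p.edges.length), (p.edges[i]'h ∈ M ↔ Odd i)

/-- A star path of `G` relative to `M`: a path of even length, alternating starting with a
non-matching edge, whose initial vertex is `M`-unsaturated. -/
def IsStarPath {V : Type} (M : Set (Sym2 V)) {G : SimpleGraph V} {a b : V}
    (p : G.Walk a b) : Prop :=
  p.IsPath ∧ Even p.length ∧ ¬ MSaturates M a ∧ IsAlternating M p

/-- `v` is a star vertex of `G` relative to `M`: some star path terminates at `v`. -/
def IsStarVertex {V : Type} (G : SimpleGraph V) (M : Set (Sym2 V)) (v : V) : Prop :=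
  ∃ a : V, ∃ p : G.Walk a v, IsStarPath M p

/-- An `M`-augmenting path: a path of odd length, alternating starting and ending with
non-matching edges, both of whose endpoints are `M`-unsaturated. -/
def IsAugPath {V : Type} (M : Set (Sym2 V)) {G : SimpleGraph V} {a b : V}
    (p : G.Walk a b) : Prop :=
  p.IsPath ∧ Odd p.length ∧ ¬ MSaturates M a ∧ ¬ MSaturates M b ∧ IsAlternating M p

/-- `G ∈ F(d,m)`: `G` is a finite simple graph with maximum degree `< d` and matching
number `< m`, edge-maximal with this property among all finite graphs on vertex sets
containing `V(G)`. -/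
def MemF (d m : ℕ) {V : Type} [Fintype V] (G : SimpleGraph V) : Prop :=
  (∀ v : V, (G.neighborSet v).ncard < d) ∧ nu G < m ∧
  ∀ (W : Type) [Fintype W] (f : V ↪ W) (G' : SimpleGraph W),
    (∀ u v : V, G.Adj u v → G'.Adj (f u) (f v)) →
    G.edgeSet.ncard < G'.edgeSet.ncard →
    (∃ w : W, d ≤ (G'.neighborSet w).ncard) ∨ m ≤ nu G'

/-- The size of every matching is at most the matching number. -/
lemma ncard_le_nu {V : Type} [Fintype V] {G : SimpleGraph V} {M : Set (Sym2 V)}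
    (hM : IsMatchingSet G M) : M.ncard ≤ nu G := by
  refine le_csSup ⟨(Set.univ : Set (Sym2 V)).ncard, ?_⟩ ⟨M, hM, rfl⟩
  rintro n ⟨N, -, rfl⟩
  exact Set.ncard_le_ncard (Set.subset_univ N)

/-- The graph obtained from `G` by adding `D` vertices adjacent to all other vertices. -/
def addUniversal {V : Type} (G : SimpleGraph V) (D : ℕ) : SimpleGraph (V ⊕ Fin D) where
  Adj x y := x ≠ y ∧ ∀ a b, x = Sum.inl a → y = Sum.inl b → G.Adj a b
  symm := ⟨fun _ _ h => ⟨h.1.symm, fun a b ha hb => (h.2 b a hb ha).symm⟩⟩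
  loopless := ⟨fun _ h => h.1 rfl⟩

open Finset Classical in
/-- A perfect matching after adding `D` universal vertices leaves at most `D` vertices of `G`
uncovered. -/
lemma card_le_of_isPerfectMatching {V : Type} [Fintype V] {G : SimpleGraph V} {D : ℕ}
    {M : (addUniversal G D).Subgraph} (hM : M.IsPerfectMatching) :
    Fintype.card V ≤ 2 * nu G + D := by
  rw [Subgraph.isPerfectMatching_iff] at hM
  choose f hf hf' using hM
  have hMset : IsMatchingSet G {e | e.map Sum.inl ∈ M.edgeSet} := by
    refine ⟨fun e he => ?_, fun e he e' he' hne v hv hv' => hne ?_⟩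
    · induction e with
      | h a b =>
        have : M.Adj (Sum.inl a) (Sum.inl b) := by simpa using he
        exact (M.adj_sub this).2 a b rfl rfl
    · obtain ⟨a, rfl⟩ := hv
      obtain ⟨b, rfl⟩ := hv'
      have h1 : M.Adj (Sum.inl v) (Sum.inl a) := by simpa using he
      have h2 : M.Adj (Sum.inl v) (Sum.inl b) := by simpa using he'
      have := (hf' _ _ h1).trans (hf' _ _ h2).symm
      rw [Sum.inl_injective this]
  have hS := ncard_le_nu hMset
  set S : Finset (Sym2 V) := {e | e.map Sum.inl ∈ M.edgeSet} with hSdef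
  have hSc : ({e | e.map Sum.inl ∈ M.edgeSet} : Set (Sym2 V)).ncard = #S := by
    rw [← Set.ncard_coe_finset]; simp [hSdef]
  rw [hSc] at hS
  have hcov : #(S.biUnion Sym2.toFinset) ≤ #S * 2 := by
    refine card_biUnion_le_card_mul _ _ _ fun e _ => ?_
    rw [Sym2.card_toFinset]; split_ifs <;> simp
  have hunc : #(univ \ S.biUnion Sym2.toFinset) ≤ D := by
    have : #(univ \ S.biUnion Sym2.toFinset)
        ≤ #((univ : Finset (Fin D)).map (Function.Embedding.inr (α := V))) := by
      refine card_le_card_of_injOn (f ∘ Sum.inl) (fun v hv => ?_) fun v _ w _ hvw => ?_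
      · rcases h : f (Sum.inl v) with a | j
        · exfalso
          have h1 := hf (Sum.inl v)
          simp only [h] at h1
          simp only [coe_sdiff, Set.mem_sdiff, mem_coe, mem_univ, mem_biUnion, true_and, not_exists,
            not_and] at hv
          exact hv s(v, a) (by simpa [hSdef] using h1) (by simp)
        · simp [h]
      · have h1 := hf (Sum.inl v)
        have h2 := hf (Sum.inl w)
        simp only [Function.comp_apply] at hvw
        simp only [hvw] at h1
        exact Sum.inl_injective ((hf' _ _ h1.symm).trans (hf' _ _ h2.symm).symm)
    simpa using this
  have := card_sdiff_add_card_eq_card (subset_univ (S.biUnion Sym2.toFinset))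
  rw [card_univ] at this
  omega

/-- A graph with a universal vertex outside a Tutte violator has odd order. -/
lemma odd_card_of_isTutteViolator {W : Type*} [Finite W] {H : SimpleGraph W} {u : Set W}
    (hu : H.IsTutteViolator u) {z : W} (hz : z ∉ u) (huniv : ∀ w, w ≠ z → H.Adj z w) :
    Odd (Nat.card W) := by
  unfold IsTutteViolator at hu
  set K := ((⊤ : H.Subgraph).deleteVerts u).coe with hK
  let z' : ((⊤ : H.Subgraph).deleteVerts u).verts := ⟨z, by simpa using hz⟩
  have hreach : ∀ x, K.Reachable z' x := by
    rintro ⟨x, hx⟩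
    by_cases hxz : x = z
    · subst hxz; exact Reachable.refl _
    · refine Adj.reachable ?_
      have hxu : x ∉ u := by simpa using hx
      simp [hK, z', hz, hxu, huniv x hxz]
  have hsub : Subsingleton K.ConnectedComponent := by
    have hc : K.Preconnected := fun x y => (hreach x).symm.trans (hreach y)
    exact hc.subsingleton_connectedComponent
  have h1 : K.oddComponents.ncard ≤ 1 := Set.ncard_le_one_of_subsingleton _
  have h0 : u = ∅ := by
    rw [← Set.ncard_eq_zero (Set.toFinite u)]; omega
  have hodd : Odd K.oddComponents.ncard := by
    have : K.oddComponents.ncard = 1 := by omega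
    rw [this]; exact odd_one
  rw [odd_ncard_oddComponents] at hodd
  subst h0
  simpa using hodd

open Finset Classical in
/-- The hard half of the Tutte–Berge formula: some vertex set `U` and partition of the remaining
vertices into unions of components of `G - U` certify a lower bound on the matching number. -/
lemma exists_tutte_berge_witness {V : Type} [Fintype V] (G : SimpleGraph V) :
    ∃ (U : Finset V) (ι : Type) (_ : Fintype ι) (c : V → ι),
      (∀ u v, u ∉ U → v ∉ U → G.Adj u v → c u = c v) ∧
      #U + ∑ i, #{v | v ∉ U ∧ c v = i} / 2 ≤ nu G := by
  by_cases hsmall : Fintype.card V ≤ 2 * nu G + 1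
  · refine ⟨∅, Unit, inferInstance, fun _ => (), by simp, ?_⟩
    simp
    omega
  set D := Fintype.card V - 2 * nu G - 2 with hD
  have hno : ¬ ∃ M : (addUniversal G D).Subgraph, M.IsPerfectMatching := by
    rintro ⟨M, hM⟩
    have := card_le_of_isPerfectMatching hM
    omega
  rw [tutte] at hno
  push Not at hno
  obtain ⟨u, hu⟩ := hno
  have hcard : Nat.card (V ⊕ Fin D) = Fintype.card V + D := by simp
  have hinr : ∀ j : Fin D, Sum.inr j ∈ u := by
    intro j
    by_contra hj
    have := odd_card_of_isTutteViolator hu hj (fun w hw => ⟨hw.symm, by simp⟩)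
    rw [hcard, Nat.odd_iff] at this
    omega
  unfold IsTutteViolator at hu
  set K := ((⊤ : (addUniversal G D).Subgraph).deleteVerts u).coe with hK
  have hmem : ∀ v : V, Sum.inl v ∉ u →
      Sum.inl v ∈ ((⊤ : (addUniversal G D).Subgraph).deleteVerts u).verts := by
    intro v hv; simpa using hv
  let U : Finset V := {v | Sum.inl v ∈ u}
  have hU : ∀ v, v ∈ U ↔ Sum.inl v ∈ u := by simp [U]
  let c : V → Option K.ConnectedComponent := fun v =>
    if h : Sum.inl v ∈ u then none else some (K.connectedComponentMk ⟨Sum.inl v, hmem v h⟩)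
  refine ⟨U, Option K.ConnectedComponent, inferInstance, c, ?_, ?_⟩
  · intro a b ha hb hab
    rw [hU] at ha hb
    simp only [c, ha, hb, dif_neg, not_false_eq_true, Option.some.injEq, ConnectedComponent.eq]
    refine Adj.reachable ?_
    have : (addUniversal G D).Adj (Sum.inl a) (Sum.inl b) := by
      refine ⟨by simpa using hab.ne, ?_⟩
      rintro _ _ ⟨⟩ ⟨⟩
      exact hab
    simp [hK, ha, hb, this]
  · have hnone : #{v | v ∉ U ∧ c v = none} = 0 := by
      rw [card_eq_zero, filter_eq_empty_iff]
      rintro v - ⟨h1, h2⟩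
      rw [hU] at h1
      simp [c, h1] at h2
    have hsome : ∀ C : K.ConnectedComponent, #{v | v ∉ U ∧ c v = some C} ≤ C.supp.ncard := by
      intro C
      rw [← Set.ncard_image_of_injective C.supp Subtype.val_injective, ← Set.ncard_coe_finset]
      refine Set.ncard_le_ncard_of_injOn Sum.inl ?_ Sum.inl_injective.injOn
      intro v hv
      simp only [coe_filter, mem_univ, true_and, Set.mem_ofPred_eq, hU] at hv
      obtain ⟨h1, h2⟩ := hv
      simp only [c, h1, dif_neg, not_false_eq_true, Option.some.injEq] at h2
      exact ⟨⟨Sum.inl v, hmem v h1⟩, h2, rfl⟩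
    have htot : ∑ C : K.ConnectedComponent, C.supp.ncard
        = Nat.card ((⊤ : (addUniversal G D).Subgraph).deleteVerts u).verts := by
      rw [Nat.card_eq_fintype_card, ← card_univ,
        card_eq_sum_card_fiberwise (f := K.connectedComponentMk) (t := univ) (by simp)]
      refine sum_congr rfl fun C _ => ?_
      rw [← Set.ncard_coe_finset]
      congr 1
      ext x
      simp
    have hverts : Nat.card ((⊤ : (addUniversal G D).Subgraph).deleteVerts u).verts + u.ncard
        = Fintype.card V + D := by
      rw [← hcard, Nat.card_coe_set_eq, ← Set.ncard_add_ncard_compl u, add_comm]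
      congr 2
      ext x
      simp
    have hucard : u.ncard = #U + D := by
      have : u = ((U.disjSum (univ : Finset (Fin D)) : Finset (V ⊕ Fin D)) : Set (V ⊕ Fin D)) := by
        ext x
        rcases x with a | j
        · simp [hU]
        · simp [hinr]
      rw [this, Set.ncard_coe_finset, card_disjSum]
      simp
    have hodd : K.oddComponents.ncard = ∑ C : K.ConnectedComponent, C.supp.ncard % 2 := by
      have : K.oddComponents = ((({C | Odd C.supp.ncard} : Finset K.ConnectedComponent)) :
          Set K.ConnectedComponent) := by ext; simp
      rw [this, Set.ncard_coe_finset, card_filter]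
      refine sum_congr rfl fun C _ => ?_
      split_ifs with h
      · exact (Nat.odd_iff.mp h).symm
      · rw [Nat.not_odd_iff_even, Nat.even_iff] at h; exact h.symm
    have hsplit : ∑ C : K.ConnectedComponent, C.supp.ncard
        = 2 * ∑ C : K.ConnectedComponent, C.supp.ncard / 2 + K.oddComponents.ncard := by
      rw [hodd, mul_sum, ← sum_add_distrib]
      exact sum_congr rfl fun C _ => (Nat.div_add_mod _ _).symm
    have hle : ∑ C : K.ConnectedComponent, #{v | v ∉ U ∧ c v = some C} / 2
        ≤ ∑ C : K.ConnectedComponent, C.supp.ncard / 2 :=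
      sum_le_sum fun C _ => Nat.div_le_div_right (hsome C)
    have hbound : #U + (#{v | v ∉ U ∧ c v = none} / 2
        + ∑ C : K.ConnectedComponent, #{v | v ∉ U ∧ c v = some C} / 2) ≤ nu G := by
      rw [hnone]
      omega
    rw [Fintype.sum_option]
    convert hbound

/-- The degree sum of a graph on `s` vertices of maximum degree at most `2 * k` is at most
`2 * (2 * k + 1) * (s / 2)`. -/
lemma mul_min_le (k s : ℕ) : s * min (2 * k) (s - 1) ≤ 2 * (2 * k + 1) * (s / 2) := by
  obtain ⟨t, rfl | rfl⟩ := s.even_or_odd'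
  · rw [Nat.mul_div_cancel_left t two_pos]
    calc 2 * t * min (2 * k) (2 * t - 1) ≤ 2 * t * (2 * k) :=
          Nat.mul_le_mul_left _ (min_le_left _ _)
      _ ≤ _ := by nlinarith
  · have : (2 * t + 1) / 2 = t := by omega
    rw [this, Nat.add_sub_cancel]
    rcases le_total k t with h | h
    · rw [min_eq_left (by omega)]; nlinarith
    · rw [min_eq_right (by omega)]; nlinarith

/-- Equality in `mul_min_le` forces `s = 2 * k + 1` once `2 ≤ s`. -/
lemma eq_of_le_mul_min {k s : ℕ} (hs : 2 ≤ s)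
    (h : 2 * (2 * k + 1) * (s / 2) ≤ s * min (2 * k) (s - 1)) : s = 2 * k + 1 := by
  obtain ⟨t, rfl | rfl⟩ := s.even_or_odd'
  · rw [Nat.mul_div_cancel_left t two_pos] at h
    have : 2 * t * min (2 * k) (2 * t - 1) ≤ 2 * t * (2 * k) :=
      Nat.mul_le_mul_left _ (min_le_left _ _)
    nlinarith
  · have : (2 * t + 1) / 2 = t := by omega
    rw [this, Nat.add_sub_cancel] at h
    rcases lt_trichotomy k t with hk | hk | hk
    · rw [min_eq_left (by omega)] at h; nlinarith
    · rw [hk]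
    · rw [min_eq_right (by omega)] at h; nlinarith

open Finset Classical in
/-- A graph without isolated vertices attaining the edge bound is a disjoint union of cliques of
size `2 * k + 1`. -/
lemma exists_clique_partition {V : Type} [Fintype V] (G : SimpleGraph V) {k : ℕ}
    (hΔ : ∀ v, G.degree v ≤ 2 * k) (hniso : ∀ v, ∃ w, G.Adj v w)
    (hE : 2 * (2 * k + 1) * nu G ≤ ∑ v, G.degree v) :
    ∃ (ι : Type) (_ : Fintype ι) (c : V → ι),
      (∀ v w, G.Adj v w ↔ c v = c w ∧ v ≠ w) ∧ ∀ v, #{w | c w = c v} = 2 * k + 1 := by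
  obtain ⟨U, ι, _, c, hc, hle⟩ := exists_tutte_berge_witness G
  have hin : ∀ i, ∀ v ∈ ({v | v ∉ U ∧ c v = i} : Finset V),
      #(G.neighborFinset v \ U) ≤ min (2 * k) (#{v | v ∉ U ∧ c v = i} - 1) := by
    intro i v hv
    refine le_min ((card_le_card sdiff_subset).trans (hΔ v)) ?_
    rw [← card_erase_of_mem hv]
    refine card_le_card fun w hw => ?_
    simp only [mem_sdiff, mem_neighborFinset, mem_filter, mem_univ, true_and, mem_erase] at *
    exact ⟨hw.1.ne', hw.2, (hc v w hv.1 hw.2 hw.1).symm.trans hv.2⟩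
  have hclass : ∀ i, ∑ v with v ∉ U ∧ c v = i, #(G.neighborFinset v \ U)
      ≤ #{v | v ∉ U ∧ c v = i} * min (2 * k) (#{v | v ∉ U ∧ c v = i} - 1) := fun i =>
    (sum_le_card_nsmul _ _ _ (hin i)).trans (by simp)
  have hclass' := fun i => (hclass i).trans (mul_min_le k _)
  have hfib : ∑ v with v ∉ U, #(G.neighborFinset v \ U)
      = ∑ i, ∑ v with v ∉ U ∧ c v = i, #(G.neighborFinset v \ U) := by
    rw [← sum_fiberwise _ c]
    exact sum_congr rfl fun i _ => by rw [filter_filter]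
  have hUdeg : ∑ v ∈ U, G.degree v ≤ #U * (2 * k) :=
    (sum_le_card_nsmul _ _ _ fun v _ => hΔ v).trans (by simp)
  have hcross : ∑ v with v ∉ U, #(G.neighborFinset v ∩ U) ≤ ∑ v ∈ U, G.degree v := by
    calc ∑ v with v ∉ U, #(G.neighborFinset v ∩ U) ≤ ∑ v, #(G.neighborFinset v ∩ U) :=
          sum_le_sum_of_subset (filter_subset _ _)
      _ = ∑ v, #(U.bipartiteAbove G.Adj v) := sum_congr rfl fun v _ => by
          congr 1; ext w; simp [mem_bipartiteAbove, and_comm]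
      _ = ∑ v ∈ U, #(univ.bipartiteBelow G.Adj v) :=
          sum_card_bipartiteAbove_eq_sum_card_bipartiteBelow _
      _ = ∑ v ∈ U, G.degree v := sum_congr rfl fun v _ => by
          rw [← card_neighborFinset_eq_degree]
          congr 1; ext w; simp [mem_bipartiteBelow, adj_comm]
  have hsum : ∑ v, G.degree v = ∑ v ∈ U, G.degree v + ∑ v with v ∉ U, #(G.neighborFinset v ∩ U)
      + ∑ v with v ∉ U, #(G.neighborFinset v \ U) := by
    rw [add_assoc, ← sum_add_distrib, ← sum_filter_add_sum_filter_not univ (· ∈ U)]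
    congr 1
    · simp
    · exact sum_congr rfl fun v _ => by
        rw [card_inter_add_card_sdiff, card_neighborFinset_eq_degree]
  have htot : ∑ i, ∑ v with v ∉ U ∧ c v = i, #(G.neighborFinset v \ U)
      ≤ ∑ i, 2 * (2 * k + 1) * (#{v | v ∉ U ∧ c v = i} / 2) := sum_le_sum fun i _ => hclass' i
  have hmul : ∑ i, 2 * (2 * k + 1) * (#{v | v ∉ U ∧ c v = i} / 2)
      = 2 * (2 * k + 1) * ∑ i, #{v | v ∉ U ∧ c v = i} / 2 := (mul_sum _ _ _).symm
  have hle' := Nat.mul_le_mul_left (2 * (2 * k + 1)) hle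
  have hU0 : U = ∅ := by
    rw [← card_eq_zero]
    nlinarith
  subst hU0
  simp only [notMem_empty, not_false_eq_true, true_and, sdiff_empty, card_neighborFinset_eq_degree,
    forall_const, card_empty, zero_add, sum_empty, inter_empty, filter_true, sum_const_zero] at *
  have heq : ∀ i, ∑ v with c v = i, G.degree v = 2 * (2 * k + 1) * (#{v | c v = i} / 2) := by
    have := (sum_eq_sum_iff_of_le fun i (_ : i ∈ univ) => hclass' i).mp (by omega)
    simpa using this
  have hsize : ∀ v, #{w | c w = c v} = 2 * k + 1 := by
    intro v
    refine eq_of_le_mul_min ?_ ((heq (c v)).symm.le.trans (hclass _))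
    obtain ⟨w, hw⟩ := hniso v
    rw [Nat.succ_le_iff, one_lt_card]
    exact ⟨v, by simp, w, by simp [hc v w hw], hw.ne⟩
  refine ⟨ι, ‹_›, c, fun v w => ⟨fun h => ⟨hc v w h, h.ne⟩, fun ⟨h, hne⟩ => ?_⟩, hsize⟩
  have hdeg : G.degree v = 2 * k := by
    have h1 := heq (c v)
    rw [hsize v] at h1
    have h2 : ∑ v' with c v' = c v, G.degree v' = ∑ v' with c v' = c v, 2 * k := by
      rw [h1, sum_const, hsize v, smul_eq_mul]
      have : (2 * k + 1) / 2 = k := by omega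
      rw [this]; ring
    exact (sum_eq_sum_iff_of_le fun v' _ => hΔ v').mp h2 v (by simp)
  have hN : G.neighborFinset v = ({w | c w = c v} : Finset V).erase v := by
    refine eq_of_subset_of_card_le (fun x hx => ?_) ?_
    · rw [mem_neighborFinset] at hx
      simp [hx.ne', (hc v x hx).symm]
    · rw [card_erase_of_mem (by simp), hsize v, card_neighborFinset_eq_degree, hdeg]
      rfl
  rw [← mem_neighborFinset, hN]
  simp [hne.symm, h.symm]

open Finset Classical in
/-- A disjoint union of `q` cliques, all of size `d`. -/
lemma nonempty_iso_of_clique_partition {V ι : Type} [Fintype V] [Fintype ι] {G : SimpleGraph V}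
    {d q : ℕ} (hd : 0 < d) (c : V → ι) (hadj : ∀ v w, G.Adj v w ↔ c v = c w ∧ v ≠ w)
    (hsize : ∀ v, #{w | c w = c v} = d) (hcard : Fintype.card V = q * d) :
    Nonempty (G ≃g SimpleGraph.fromRel (fun a b : Fin q × Fin d => a.1 = b.1)) := by
  let r : V → Set.range c := Set.rangeFactorization c
  have hfib : ∀ y : Set.range c, Nonempty ({v // r v = y} ≃ Fin d) := by
    rintro ⟨_, v, rfl⟩
    refine ⟨Fintype.equivFinOfCardEq ?_⟩
    rw [Fintype.card_subtype, ← hsize v]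
    congr 1
    ext w
    simp [r, Set.rangeFactorization, Subtype.ext_iff]
  let E : V ≃ Set.range c × Fin d := (Equiv.sigmaFiberEquiv r).symm.trans
    ((Equiv.sigmaCongrRight fun y => (hfib y).some).trans (Equiv.sigmaEquivProd _ _))
  have hE : ∀ v, (E v).1 = r v := fun _ => rfl
  have hrange : Fintype.card (Set.range c) = q := by
    have := Fintype.card_congr E
    rw [Fintype.card_prod, Fintype.card_fin, hcard] at this
    exact (Nat.eq_of_mul_eq_mul_right hd this).symm
  let F := E.trans ((Fintype.equivFinOfCardEq hrange).prodCongr (Equiv.refl (Fin d)))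
  refine ⟨⟨F, fun {v w} => ?_⟩⟩
  have hF : (F v).1 = (F w).1 ↔ c v = c w := by
    simp [F, hE, r, Set.rangeFactorization, Subtype.ext_iff]
  rw [fromRel_adj, hadj, hF, eq_comm (a := (F w).1), hF, F.injective.ne_iff]
  tauto

/-- for odd `d ≥ 3` with `(d-1)/2 ∣ m-1`, any graph with `Δ < d`, `ν < m`,
no isolated vertices and exactly `(d-1)(m-1) + (m-1)` edges is the disjoint union of
`2(m-1)/(d-1)` copies of `K_d`. -/
theorem stmt_14 {d m : ℕ} (hd3 : 3 ≤ d) (hodd : Odd d) (hm : 2 ≤ m)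
    (hdvd : (d - 1) / 2 ∣ (m - 1)) {V : Type} [Fintype V]
    (G : SimpleGraph V) (hΔ : ∀ v : V, (G.neighborSet v).ncard < d) (hν : nu G < m)
    (hniso : ∀ v : V, ∃ w : V, G.Adj v w)
    (hE : G.edgeSet.ncard = (d - 1) * (m - 1) + (m - 1)) :
    Nonempty (G ≃g SimpleGraph.fromRel
      (fun a b : Fin (2 * (m - 1) / (d - 1)) × Fin d => a.1 = b.1)) := by
  classical
  obtain ⟨k, rfl⟩ := hodd
  have hk : 0 < k := by omega
  have h2k : (2 * k + 1 - 1) / 2 = k := by omega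
  rw [h2k] at hdvd
  obtain ⟨q, hq⟩ := hdvd
  have hdeg : ∀ v, G.degree v ≤ 2 * k := fun v => by
    have := hΔ v
    rw [Set.ncard_eq_toFinset_card', ← neighborFinset_def, card_neighborFinset_eq_degree] at this
    omega
  have hsum : ∑ v, G.degree v = 2 * (2 * k + 1) * (m - 1) := by
    rw [sum_degrees_eq_twice_card_edges, edgeFinset, ← Set.ncard_eq_toFinset_card', hE,
      Nat.add_sub_cancel]
    ring
  obtain ⟨ι, _, c, hadj, hsize⟩ := exists_clique_partition G hdeg hniso
    (hsum ▸ Nat.mul_le_mul_left _ (by omega))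
  have hreg : ∀ v, G.degree v = 2 * k := fun v => by
    have hN : G.neighborFinset v = (Finset.univ.filter fun w => c w = c v).erase v := by
      ext w
      simp [hadj, eq_comm, and_comm]
    rw [← card_neighborFinset_eq_degree, hN, Finset.card_erase_of_mem (by simp)]
    refine Nat.sub_eq_of_eq_add ?_
    convert hsize v
  have hcard : Fintype.card V = q * (2 * k + 1) := by
    simp only [hreg, Finset.sum_const, Finset.card_univ, smul_eq_mul, hq] at hsum
    refine Nat.eq_of_mul_eq_mul_right (show 0 < 2 * k by omega) ?_
    rw [hsum]; ring
  have hq' : 2 * (m - 1) / (2 * k + 1 - 1) = q := by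
    rw [hq, Nat.add_sub_cancel, ← mul_assoc, Nat.mul_div_cancel_left _ (by omega)]
  rw [hq']
  exact nonempty_iso_of_clique_partition (by omega) c hadj hsize hcard
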